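/- Assume m ≥ 3, n ≥ 2 and rewards with r_0 = 0, r_1 = 0 and r_2 = 1. Then for every 0 < ε < 1/4, every N ∈ ℕ, and every function 𝒜 : Θ_all^N → C_unbounded, the infimum over finitely supported probability distributions D on Θ_all of P_{S∼D^N}[ E_{θ∼D}[u_p(θ, 𝒜(S))] ≥ OPT(C_unbounded, D) − ε ] equals 0; equivalently, for every 0 < δ < 1 there exists a finitely supported D such that with probability at least δ over S ∼ D^N, E_{θ∼D}[u_p(θ, 𝒜(S))] < OPT(C_unbounded, D) − ε. Hence no learning algorithm with finite sample complexity exists for the class of unbounded contracts. -/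

import Mathlib

open scoped BigOperators

/-- An agent type in the hidden-action principal-agent model with `n` actions and
`m` outcomes: a production function `f` (a distribution over outcomes for each action)
and a nonnegative cost vector `c` with `c 0 = 0`. -/
structure AgentType (n m : ℕ) where
  f : Fin n → Fin m → ℝ
  c : Fin n → ℝ
  f_nonneg : ∀ i j, 0 ≤ f i j
  f_sum : ∀ i, ∑ j, f i j = 1
  c_nonneg : ∀ i, 0 ≤ c i
  c_zero : ∀ i : Fin n, (i : ℕ) = 0 → c i = 0

/-- The agent's expected utility for action `i` under contract `t`. -/
def uA {n m : ℕ} (θ : AgentType n m) (t : Fin m → ℝ) (i : Fin n) : ℝ :=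
  (∑ j, θ.f i j * t j) - θ.c i

/-- The principal's expected utility when the agent takes action `i` under contract `t`,
with rewards `r`. -/
def uPa {n m : ℕ} (r : Fin m → ℝ) (θ : AgentType n m) (t : Fin m → ℝ) (i : Fin n) : ℝ :=
  ∑ j, θ.f i j * (r j - t j)

/-- The set of the agent's best-response actions to contract `t`. -/
def BestResp {n m : ℕ} (θ : AgentType n m) (t : Fin m → ℝ) : Set (Fin n) :=
  {i | ∀ i', uA θ t i' ≤ uA θ t i}

/-- The principal's utility under contract `t`: the agent best-responds, breaking ties
in favor of the principal. -/
noncomputable def uP {n m : ℕ} (r : Fin m → ℝ) (θ : AgentType n m) (t : Fin m → ℝ) : ℝ :=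
  sSup (uPa r θ t '' BestResp θ t)

/-- The class of linear contracts `α • r`, `α ∈ [0,1]`. -/
def Clinear {m : ℕ} (r : Fin m → ℝ) : Set (Fin m → ℝ) :=
  {t | ∃ α : ℝ, α ∈ Set.Icc (0:ℝ) 1 ∧ t = fun j => α * r j}

/-- The class of bounded contracts `[0,1]^m`. -/
def Cbounded (m : ℕ) : Set (Fin m → ℝ) := {t | ∀ j, t j ∈ Set.Icc (0:ℝ) 1}

/-- The class of unbounded contracts `ℝ_{≥0}^m`. -/
def Cunbounded (m : ℕ) : Set (Fin m → ℝ) := {t | ∀ j, 0 ≤ t j}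

/-- A finitely supported probability distribution. -/
structure FinDist (α : Type*) where
  p : α → ℝ
  nonneg : ∀ a, 0 ≤ p a
  finite_support : (Function.support p).Finite
  total : ∑ᶠ a, p a = 1

/-- Expectation of `g` under a finitely supported distribution `D`. -/
noncomputable def expect {α : Type*} (D : FinDist α) (g : α → ℝ) : ℝ :=
  ∑ᶠ a, D.p a * g a

/-- `OPT(C, D)`: the supremum over contracts in `C` of the principal's expected utility. -/
noncomputable def OPT {n m : ℕ} (C : Set (Fin m → ℝ)) (r : Fin m → ℝ)
    (D : FinDist (AgentType n m)) : ℝ :=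
  sSup ((fun t => expect D (fun θ => uP r θ t)) '' C)

/-- Pseudo-dimension shattering: `C` shatters some `k` types in `Θ`. -/
def Shatters {n m : ℕ} (r : Fin m → ℝ) (C : Set (Fin m → ℝ))
    (Θ : Set (AgentType n m)) (k : ℕ) : Prop :=
  ∃ θ : Fin k → AgentType n m, (∀ j, θ j ∈ Θ) ∧ ∃ τ : Fin k → ℝ,
    ∀ S : Finset (Fin k), ∃ t ∈ C,
      (∀ j, j ∈ S → τ j ≤ uP r (θ j) t) ∧ (∀ j, j ∉ S → uP r (θ j) t < τ j)

/-- `Cbar` is an `ε`-approximation of `C` (representation error at most `ε`). -/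
def IsApprox (n : ℕ) {m : ℕ} (r : Fin m → ℝ) (Cbar C : Set (Fin m → ℝ)) (ε : ℝ) : Prop :=
  ∀ D : FinDist (AgentType n m), OPT Cbar r D ≥ OPT C r D - ε

/-- Best responses breaking ties in favor of the principal. -/
def BestRespP {n m : ℕ} (r : Fin m → ℝ) (θ : AgentType n m) (t : Fin m → ℝ) : Set (Fin n) :=
  {i | i ∈ BestResp θ t ∧ ∀ i' ∈ BestResp θ t, uPa r θ t i' ≤ uPa r θ t i}

/-- Principal's expected reward under the linear contract `α • r`. -/
noncomputable def rP {n m : ℕ} (r : Fin m → ℝ) (θ : AgentType n m) (α : ℝ) : ℝ :=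
  sSup ((fun i => ∑ j, θ.f i j * r j) '' BestRespP r θ (fun j => α * r j))

/-- The set of critical values of an agent type for linear contracts. -/
def CritSet {n m : ℕ} (r : Fin m → ℝ) (θ : AgentType n m) : Set ℝ :=
  {α | α ∈ Set.Ioc (0:ℝ) 1 ∧ ∀ ε : ℝ, 0 < ε → ε ≤ α → rP r θ (α - ε) ≠ rP r θ α}

/-- Probability of the event `E` under `N` i.i.d. samples from `D`. -/
noncomputable def prodProb {α : Type*} (D : FinDist α) (N : ℕ) (E : Set (Fin N → α)) : ℝ :=
  ∑ᶠ s ∈ E, ∏ i, D.p (s i)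

/-- The class of `ε`-discrete linear contracts. -/
def Leps {m : ℕ} (r : Fin m → ℝ) (ε : ℝ) : Set (Fin m → ℝ) :=
  {t | ∃ α : ℝ, ((∃ k : ℕ, α = k * ε ∧ k * ε ≤ 1) ∨ α = 1) ∧ t = fun j => α * r j}

/-- The distribution giving weight `a` to `x` and `1 - a` to `y`. -/
def twoPoint {α : Type*} [DecidableEq α] (a : ℝ) (x y : α) (j : α) : ℝ :=
  (if j = x then a else 0) + (if j = y then 1 - a else 0)

lemma twoPoint_nonneg {α : Type*} [DecidableEq α] {a : ℝ} (h0 : 0 ≤ a) (h1 : a ≤ 1)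
    (x y j : α) : 0 ≤ twoPoint a x y j := by
  unfold twoPoint
  split_ifs <;> linarith

lemma sum_twoPoint_mul {α : Type*} [DecidableEq α] [Fintype α] (a : ℝ) (x y : α) (g : α → ℝ) :
    ∑ j, twoPoint a x y j * g j = a * g x + (1 - a) * g y := by
  simp [twoPoint, add_mul, Finset.sum_add_distrib]

lemma sum_twoPoint {α : Type*} [DecidableEq α] [Fintype α] (a : ℝ) (x y : α) :
    ∑ j, twoPoint a x y j = 1 := by
  simp [twoPoint, Finset.sum_add_distrib]

lemma support_twoPoint_mul_subset {α : Type*} [DecidableEq α] (a : ℝ) (x y : α) (g : α → ℝ) :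
    Function.support (fun j => twoPoint a x y j * g j) ⊆ ({x, y} : Finset α) := by
  intro j hj
  by_contra h
  simp only [Finset.coe_insert, Finset.coe_singleton, Set.mem_insert_iff,
    Set.mem_singleton_iff, not_or] at h
  exact hj (by simp [twoPoint, h.1, h.2])

lemma finsum_twoPoint_mul {α : Type*} [DecidableEq α] (a : ℝ) (x y : α) (g : α → ℝ) :
    ∑ᶠ j, twoPoint a x y j * g j = a * g x + (1 - a) * g y := by
  rw [finsum_eq_sum_of_support_subset _ (support_twoPoint_mul_subset a x y g)]
  by_cases h : x = y
  · simp [twoPoint, h]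
    ring
  · simp [twoPoint, h, Ne.symm h]

open Classical in
/-- The mixture of two point masses as a finitely supported distribution. -/
noncomputable def FinDist.twoPoint {α : Type*} (a : ℝ) (h0 : 0 ≤ a) (h1 : a ≤ 1) (x y : α) :
    FinDist α where
  p := _root_.twoPoint a x y
  nonneg := twoPoint_nonneg h0 h1 x y
  finite_support := by
    have h := support_twoPoint_mul_subset a x y fun _ => 1
    simp only [mul_one] at h
    exact (Finset.finite_toSet _).subset h
  total := by simpa using finsum_twoPoint_mul a x y fun _ => 1

lemma expect_twoPoint {α : Type*} {a : ℝ} (h0 : 0 ≤ a) (h1 : a ≤ 1) (x y : α) (g : α → ℝ) :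
    expect (FinDist.twoPoint a h0 h1 x y) g = a * g x + (1 - a) * g y := by
  classical
  exact finsum_twoPoint_mul a x y g

lemma pow_le_prodProb {α : Type*} (D : FinDist α) (N : ℕ) (E : Set (Fin N → α)) {x : α}
    (hx : (fun _ => x) ∈ E) : D.p x ^ N ≤ prodProb D N E := by
  have hfin : (Function.support fun s : Fin N → α => ∏ i, D.p (s i)).Finite := by
    refine (Set.Finite.pi' fun _ : Fin N => D.finite_support).subset fun s hs i => ?_
    exact fun h => hs (Finset.prod_eq_zero (Finset.mem_univ i) h)
  have hnonneg (s : Fin N → α) : 0 ≤ ∏ i, D.p (s i) := Finset.prod_nonneg fun i _ => D.nonneg _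
  unfold prodProb
  rw [finsum_mem_def]
  have h := single_le_finsum (fun _ => x)
    (f := fun s => E.indicator (fun s => ∏ i, D.p (s i)) s)
    (hfin.subset (by
      rw [Set.support_indicator]
      exact Set.inter_subset_right))
    fun s => Set.indicator_nonneg (fun s _ => hnonneg s) s
  simpa [hx] using h

lemma pow_le_prodProb_twoPoint {α : Type*} {a : ℝ} (h0 : 0 ≤ a) (h1 : a ≤ 1) (x y : α) (N : ℕ)
    (E : Set (Fin N → α)) (hx : (fun _ => x) ∈ E) :
    a ^ N ≤ prodProb (FinDist.twoPoint a h0 h1 x y) N E := by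
  classical
  refine le_trans (pow_le_pow_left₀ h0 ?_ N) (pow_le_prodProb _ N E hx)
  change a ≤ twoPoint a x y x
  unfold twoPoint
  split_ifs <;> simp_all

lemma bestResp_nonempty {n m : ℕ} [NeZero n] (θ : AgentType n m) (t : Fin m → ℝ) :
    (BestResp θ t).Nonempty :=
  Finite.exists_max (uA θ t)

lemma uP_le {n m : ℕ} [NeZero n] {r : Fin m → ℝ} {θ : AgentType n m} {t : Fin m → ℝ} {b : ℝ}
    (h : ∀ i ∈ BestResp θ t, uPa r θ t i ≤ b) : uP r θ t ≤ b :=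
  csSup_le ((bestResp_nonempty θ t).image _) (Set.forall_mem_image.2 h)

lemma uPa_le_uP {n m : ℕ} {r : Fin m → ℝ} {θ : AgentType n m} {t : Fin m → ℝ} {i : Fin n}
    (h : i ∈ BestResp θ t) : uPa r θ t i ≤ uP r θ t :=
  le_csSup (Set.toFinite _).bddAbove (Set.mem_image_of_mem _ h)

lemma expect_le_OPT_twoPoint {n m : ℕ} {C : Set (Fin m → ℝ)} {r : Fin m → ℝ} {a b : ℝ}
    (h0 : 0 ≤ a) (h1 : a ≤ 1) {x y : AgentType n m}
    (hx : ∀ t ∈ C, uP r x t ≤ b) (hy : ∀ t ∈ C, uP r y t ≤ b) {t : Fin m → ℝ} (ht : t ∈ C) :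
    a * uP r x t + (1 - a) * uP r y t ≤ OPT C r (FinDist.twoPoint a h0 h1 x y) := by
  rw [← expect_twoPoint h0 h1 x y fun θ => uP r θ t]
  refine le_csSup ⟨b, ?_⟩ (Set.mem_image_of_mem _ ht)
  rintro _ ⟨s, hs, rfl⟩
  simp only [expect_twoPoint]
  nlinarith [hx s hs, hy s hs]

/-- An agent whose every action leads to outcome `x` at no cost. -/
def constAgent (n : ℕ) {m : ℕ} (x : Fin m) : AgentType n m where
  f _ := twoPoint 1 x x
  c _ := 0
  f_nonneg _ := twoPoint_nonneg zero_le_one le_rfl x x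
  f_sum _ := sum_twoPoint 1 x x
  c_nonneg _ := le_rfl
  c_zero _ _ := rfl

lemma uPa_constAgent {n m : ℕ} (r t : Fin m → ℝ) (x : Fin m) (i : Fin n) :
    uPa r (constAgent n x) t i = r x - t x := by
  simp [uPa, constAgent, sum_twoPoint_mul]

lemma uP_constAgent {n m : ℕ} [NeZero n] (r t : Fin m → ℝ) (x : Fin m) :
    uP r (constAgent n x) t = r x - t x := by
  obtain ⟨i, hi⟩ := bestResp_nonempty (constAgent n x) t
  exact le_antisymm (uP_le fun i _ => (uPa_constAgent r t x i).le)
    ((uPa_constAgent r t x i).symm.le.trans (uPa_le_uP hi))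

/-- An agent for whom action `1` costs `1/4` and leads to the rare outcome `y` with probability
`p` and to `z` otherwise, while every other action is free and leads to `x` or `z` with equal
probability. -/
noncomputable def rareAgent (n : ℕ) {m : ℕ} (p : ℝ) (h0 : 0 ≤ p) (h1 : p ≤ 1) (x y z : Fin m) :
    AgentType n m where
  f i := if (i : ℕ) = 1 then twoPoint p y z else twoPoint (1 / 2) x z
  c i := if (i : ℕ) = 1 then 1 / 4 else 0
  f_nonneg i := by
    split_ifs
    · exact twoPoint_nonneg h0 h1 y z
    · exact twoPoint_nonneg (by norm_num) (by norm_num) x z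
  f_sum i := by split_ifs <;> exact sum_twoPoint _ _ _
  c_nonneg i := by split_ifs <;> norm_num
  c_zero i hi := by simp [hi]

section rareAgent

variable {n m : ℕ} {p : ℝ} (h0 : 0 ≤ p) (h1 : p ≤ 1) (x y z : Fin m) (r t : Fin m → ℝ)

lemma uA_rareAgent (i : Fin n) :
    uA (rareAgent n p h0 h1 x y z) t i =
      if (i : ℕ) = 1 then p * t y + (1 - p) * t z - 1 / 4
      else 1 / 2 * t x + 1 / 2 * t z := by
  unfold uA rareAgent
  split_ifs with h
  · simp only [h, if_true, sum_twoPoint_mul]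
  · simp only [h, if_false, sum_twoPoint_mul]
    ring

lemma uPa_rareAgent (i : Fin n) :
    uPa r (rareAgent n p h0 h1 x y z) t i =
      if (i : ℕ) = 1 then p * (r y - t y) + (1 - p) * (r z - t z)
      else 1 / 2 * (r x - t x) + 1 / 2 * (r z - t z) := by
  unfold uPa rareAgent
  split_ifs with h
  · simp only [h, if_true, sum_twoPoint_mul]
  · simp only [h, if_false, sum_twoPoint_mul]
    ring

variable {x y z r t}

lemma uP_rareAgent_le_one [NeZero n] (hx : r x = 0) (hy : r y = 0) (hz : r z = 1)
    (ht : ∀ j, 0 ≤ t j) : uP r (rareAgent n p h0 h1 x y z) t ≤ 1 := by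
  refine uP_le fun i _ => ?_
  rw [uPa_rareAgent, hx, hy, hz]
  have := ht x
  have := mul_nonneg h0 (ht y)
  have := mul_nonneg (sub_nonneg.2 h1) (ht z)
  have := ht z
  split_ifs <;> linarith

lemma uP_rareAgent_le_of_le (hn : 2 ≤ n) (hx : r x = 0) (hy : r y = 0) (hz : r z = 1)
    (ht : ∀ j, 0 ≤ t j) {T : ℝ} (hT : t y ≤ T) :
    uP r (rareAgent n p h0 h1 x y z) t ≤ 1 / 2 + 2 * (p * T) := by
  have : NeZero n := ⟨by omega⟩
  refine uP_le fun i hi => ?_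
  have hi := hi ⟨0, by omega⟩
  rw [uA_rareAgent, uA_rareAgent, if_neg zero_ne_one] at hi
  rw [uPa_rareAgent, hx, hy, hz]
  have := ht x
  have := ht z
  have := mul_nonneg h0 (ht y)
  have := mul_nonneg h0 (ht z)
  have := mul_le_mul_of_nonneg_left hT h0
  split_ifs at hi ⊢ <;> linarith

lemma zero_le_uP_rareAgent_zero (hn : 2 ≤ n) (hx : r x = 0) (hz : r z = 1) :
    0 ≤ uP r (rareAgent n p h0 h1 x y z) 0 := by
  have hmem : (⟨0, by omega⟩ : Fin n) ∈ BestResp (rareAgent n p h0 h1 x y z) 0 := by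
    intro i
    rw [uA_rareAgent, uA_rareAgent]
    split_ifs <;> simp_all
  refine le_trans ?_ (uPa_le_uP hmem)
  rw [uPa_rareAgent]
  simp [hx, hz]

lemma le_uP_rareAgent_single (hn : 2 ≤ n) (hp : 0 < p) (hxy : x ≠ y) (hzy : z ≠ y)
    (hy : r y = 0) (hz : r z = 1) :
    3 / 4 - p ≤ uP r (rareAgent n p h0 h1 x y z) (Pi.single y (1 / (4 * p))) := by
  have hpay : p * (1 / (4 * p)) = 1 / 4 := by field_simp
  have hmem : (⟨1, by omega⟩ : Fin n) ∈
      BestResp (rareAgent n p h0 h1 x y z) (Pi.single y (1 / (4 * p))) := by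
    intro i
    rw [uA_rareAgent, uA_rareAgent]
    simp only [Pi.single_eq_same, Pi.single_eq_of_ne hxy, Pi.single_eq_of_ne hzy, hpay]
    split_ifs <;> norm_num
  refine le_trans ?_ (uPa_le_uP hmem)
  rw [uPa_rareAgent]
  simp only [Pi.single_eq_same, Pi.single_eq_of_ne hzy, hy, hz, if_true, mul_sub, hpay]
  linarith

end rareAgent

/-- Impossibility of learning unbounded contracts. With `m ≥ 3`, `n ≥ 2`
and rewards `r 0 = 0`, `r 1 = 0`, `r 2 = 1`, for every `0 < ε < 1/4`, every sample size
`N` and every learning rule `𝒜` returning unbounded contracts, and every `0 < δ < 1`,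
there is a finitely supported distribution `D` such that with probability at least `δ`
the returned contract is more than `ε`-suboptimal: no learning algorithm with finite
sample complexity exists. -/
theorem stmt_17 (n m : ℕ) (hn : 2 ≤ n) (hm : 3 ≤ m) (r : Fin m → ℝ)
    (hr : ∀ j, 0 ≤ r j)
    (hr0 : r ⟨0, by omega⟩ = 0) (hr1 : r ⟨1, by omega⟩ = 0) (hr2 : r ⟨2, by omega⟩ = 1)
    (ε : ℝ) (hε0 : 0 < ε) (hε : ε < 1/4) (N : ℕ)
    (𝒜 : (Fin N → AgentType n m) → (Fin m → ℝ)) (h𝒜 : ∀ s, 𝒜 s ∈ Cunbounded m) :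
    ∀ δ : ℝ, 0 < δ → δ < 1 →
      ∃ D : FinDist (AgentType n m),
        prodProb D N
          {s | expect D (fun θ => uP r θ (𝒜 s)) < OPT (Cunbounded m) r D - ε} ≥ δ := by
  intro δ hδ0 hδ1
  have : NeZero n := ⟨by omega⟩
  obtain ⟨μ, hμ0, hμ1, hμN⟩ : ∃ μ : ℝ, 0 < μ ∧ μ ≤ 1 ∧ δ ≤ (1 - μ) ^ N := by
    have hN : (0 : ℝ) ≤ N := N.cast_nonneg
    have hμ0 : 0 < (1 - δ) / (N + 1) := div_pos (by linarith) (by linarith)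
    have hmul : (1 - δ) / (N + 1) * (N + 1) = 1 - δ := by field_simp
    have hμ1 : (1 - δ) / (N + 1) ≤ 1 := (div_le_one (by linarith)).2 (by linarith)
    refine ⟨_, hμ0, hμ1, ?_⟩
    have := one_add_mul_le_pow (a := -((1 - δ) / (N + 1))) (by linarith) N
    rw [← sub_eq_add_neg] at this
    linarith
  obtain ⟨T, hT0, hT⟩ : ∃ T : ℝ, 0 ≤ T ∧ μ * T = 2 :=
    ⟨2 / μ, by positivity, by field_simp⟩
  obtain ⟨p, hp0, hp⟩ : ∃ p : ℝ, 0 < p ∧ 2 * (p * T) + p < 1 / 4 - ε := by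
    refine ⟨(1 / 4 - ε) / (2 * (2 * T + 1)), div_pos (by linarith) (by linarith), ?_⟩
    have : (1 / 4 - ε) / (2 * (2 * T + 1)) * (2 * T + 1) = (1 / 4 - ε) / 2 := by field_simp
    linarith
  have hp1 : p ≤ 1 := by nlinarith
  set x : Fin m := ⟨0, by omega⟩
  set y : Fin m := ⟨1, by omega⟩
  set z : Fin m := ⟨2, by omega⟩
  have hxy : x ≠ y := by simp [x, y]
  have hzy : z ≠ y := by simp [z, y]
  set bulk := rareAgent n p hp0.le hp1 x y z
  set rare := constAgent n y
  set t := 𝒜 fun _ => bulk with ht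
  have htn : ∀ j, 0 ≤ t j := h𝒜 _
  have hbulk : ∀ t ∈ Cunbounded m, uP r bulk t ≤ 1 := fun t ht =>
    uP_rareAgent_le_one hp0.le hp1 hr0 hr1 hr2 ht
  have hrare : ∀ t ∈ Cunbounded m, uP r rare t ≤ 1 := fun t ht => by
    rw [uP_constAgent, hr1]
    linarith [ht y]
  rcases le_or_gt (t y) T with hle | hgt
  · refine ⟨FinDist.twoPoint 1 zero_le_one le_rfl bulk rare,
      le_trans ?_ (pow_le_prodProb_twoPoint _ _ _ _ _ _ ?_)⟩
    · simpa using hδ1.le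
    · rw [Set.mem_ofPred_eq, ← ht, expect_twoPoint]
      have hmem : Pi.single y (1 / (4 * p)) ∈ Cunbounded m := by
        have h : (0 : Fin m → ℝ) ≤ Pi.single y (1 / (4 * p)) :=
          Pi.single_nonneg.2 (by positivity)
        exact h
      have hopt := expect_le_OPT_twoPoint zero_le_one le_rfl hbulk hrare hmem
      have hlow := le_uP_rareAgent_single hp0.le hp1 hn hp0 hxy hzy hr1 hr2
      have hup := uP_rareAgent_le_of_le hp0.le hp1 hn hr0 hr1 hr2 htn hle
      linarith
  · have hμ0' : 0 ≤ 1 - μ := by linarith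
    have hμ1' : 1 - μ ≤ 1 := by linarith
    refine ⟨FinDist.twoPoint (1 - μ) hμ0' hμ1' bulk rare,
      hμN.trans (pow_le_prodProb_twoPoint _ _ _ _ _ _ ?_)⟩
    rw [Set.mem_ofPred_eq, ← ht, expect_twoPoint]
    have hopt := expect_le_OPT_twoPoint hμ0' hμ1' hbulk hrare
      (t := 0) (fun _ => le_rfl)
    have hzero := zero_le_uP_rareAgent_zero hp0.le hp1 (y := y) hn hr0 hr2
    have hprod := mul_nonneg hμ0' hzero
    rw [uP_constAgent, hr1] at hopt ⊢
    simp only [Pi.zero_apply] at hopt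
    have := mul_le_mul_of_nonneg_left (hbulk t htn) hμ0'
    have := mul_lt_mul_of_pos_left hgt hμ0
    linarith
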